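/- For every positive integer t, in the ring of formal power series ℤ[[q]] one has ∑_{k ≥ 0} ∑_{λ ∈ 𝒜_t,k} q^{|λ|} · (q;q)_∞ = (−q;q)_∞ · (q;q^{t+2})_∞ · (q^{t+1};q^{t+2})_∞ · (q^{t+2};q^{t+2})_∞, where for each k ≥ 0, 𝒜_{t,k} is the set of λ ∈ ℤ^k with 0 < λ_1/k ≤ λ_2/(k−1) ≤ ⋯ ≤ λ_k/1 ≤ t (for k = 0 this is the empty composition). -/

import Mathlib

open PowerSeries

/-- The infinite product `∏_{i=0}^∞ (1 + e·q^(c + d·i))` as a formal power series in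
`ℤ[[q]]` (for `c ≥ 1`, `d ≥ 1` the coefficient of `q^N` is already determined by the
partial product of the first `N+1` factors, which is how it is defined here).
Taking `e = -1, c = 1, d = 1` gives `(q;q)_∞`; `e = 1, c = 1, d = 1` gives `(-q;q)_∞`;
`e = -1` with general `c, d` gives `(q^c; q^d)_∞`. -/
noncomputable def pochInf (e : ℤ) (c d : ℕ) : PowerSeries ℤ :=
  PowerSeries.mk fun N => PowerSeries.coeff N
    (∏ i ∈ Finset.range (N + 1), (1 + PowerSeries.C e * X ^ (c + d * i)))

/-- `lam` is an anti-lecture hall composition of length `k` in `𝒜_t`: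
`0 < lam₁/k ≤ lam₂/(k-1) ≤ ⋯ ≤ lam_k/1 ≤ t` (0-based: the part at index `i`
has denominator `k - i`). -/
def MemAt (t k : ℕ) (lam : Fin k → ℕ) : Prop :=
  (∀ j : Fin k, ((j : ℕ) = 0 → 0 < lam j) ∧ ((j : ℕ) = k - 1 → lam j ≤ t)) ∧
  ∀ i j : Fin k, (j : ℕ) = (i : ℕ) + 1 →
    lam i * (k - (j : ℕ)) ≤ lam j * (k - (i : ℕ))

/-- `tri n = n (n - 1) / 2`. -/
def tri : ℕ → ℕ
  | 0 => 0
  | n + 1 => tri n + n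

theorem tri_two (n : ℕ) : 2 * tri n + n = n * n := by
  induction n with
  | zero => rfl
  | succ n ih => simp only [tri]; nlinarith

section Abstract

variable {R : Type*} [CommRing R]

/-- The Euler series `∑ x^i U_i y^i`. -/
noncomputable def E1 (U : ℕ → R) (x : R) : R⟦X⟧ := PowerSeries.mk fun i => x ^ i * U i

/-- The Euler series `∑ (-1)^i P^(i choose 2) x^i U_i y^i`. -/
noncomputable def E2 (P : R) (U : ℕ → R) (x : R) : R⟦X⟧ :=
  PowerSeries.mk fun i => (-1) ^ i * P ^ tri i * x ^ i * U i

/-- `U` is the sequence of inverses of `(P;P)_i`. -/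
structure IsInvPoch (P : R) (U : ℕ → R) : Prop where
  zero : U 0 = 1
  succ : ∀ i, (1 - P ^ (i + 1)) * U (i + 1) = U i
  ne : ∀ i, 1 - P ^ (i + 1) ≠ 0

theorem coeff_succ_one_sub_mul (x : R) (S : R⟦X⟧) (n : ℕ) :
    coeff (n + 1) ((1 - C x * X) * S) = coeff (n + 1) S - x * coeff n S := by
  rw [sub_mul, one_mul, map_sub, mul_assoc, coeff_C_mul, coeff_succ_X_mul]

theorem coeff_zero_one_sub_mul (x : R) (S : R⟦X⟧) :
    coeff 0 ((1 - C x * X) * S) = coeff 0 S := by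
  rw [sub_mul, one_mul, map_sub, mul_assoc, coeff_C_mul, coeff_zero_X_mul]; simp

variable {P : R} {U : ℕ → R}

theorem E1_step (h : IsInvPoch P U) (x : R) :
    (1 - C x * X) * E1 U x = E1 U (x * P) := by
  ext n
  cases n with
  | zero => rw [coeff_zero_one_sub_mul]; simp [E1]
  | succ n =>
    rw [coeff_succ_one_sub_mul]; simp only [E1, coeff_mk]
    have := h.succ n
    linear_combination (-x ^ (n + 1)) * (-this)

theorem E2_step (h : IsInvPoch P U) (x : R) :
    E2 P U x = (1 - C x * X) * E2 P U (x * P) := by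
  ext n
  cases n with
  | zero => rw [coeff_zero_one_sub_mul]; simp [E2]
  | succ n =>
    rw [coeff_succ_one_sub_mul]; simp only [E2, coeff_mk, tri]
    have := h.succ n
    linear_combination ((-1) ^ (n + 1) * P ^ (tri n + n) * x ^ (n + 1)) * (this)

theorem coeff_E2E1_scale (x z : R) (n : ℕ) :
    coeff n (E2 P U (x * P) * E1 U (z * P)) = P ^ n * coeff n (E2 P U x * E1 U z) := by
  simp only [coeff_mul, E1, E2, coeff_mk, Finset.mul_sum]
  refine Finset.sum_congr rfl fun p hp => ?_
  rw [Finset.HasAntidiagonal.mem_antidiagonal] at hp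
  rw [← hp]; ring

section Domain
variable [IsDomain R]

/-- The (homogeneous) `q`-binomial theorem. -/
theorem coeff_E2E1 (h : IsInvPoch P U) (x z : R) (n : ℕ) :
    coeff n (E2 P U x * E1 U z) = U n * ∏ i ∈ Finset.range n, (z - x * P ^ i) := by
  induction n with
  | zero => simp [E1, E2, h.zero, tri]
  | succ n ih =>
    have h1 : (1 - C z * X) * (E2 P U x * E1 U z)
        = (1 - C x * X) * (E2 P U (x * P) * E1 U (z * P)) := by
      rw [← E1_step h, E2_step h x]; ring
    have h2 := congrArg (coeff (n + 1)) h1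
    rw [coeff_succ_one_sub_mul, coeff_succ_one_sub_mul, coeff_E2E1_scale, coeff_E2E1_scale,
      ih] at h2
    apply mul_left_cancel₀ (h.ne n)
    rw [Finset.prod_range_succ]
    have := h.succ n
    linear_combination h2 - (∏ i ∈ Finset.range n, (z - x * P ^ i)) * (z - x * P ^ n) * this

theorem E2_mul_E1 (h : IsInvPoch P U) (x : R) : E2 P U x * E1 U x = 1 := by
  ext n
  rw [coeff_E2E1 h]
  cases n with
  | zero => simp [h.zero]
  | succ n => rw [Finset.prod_range_succ']; simp [coeff_one]

theorem chu (h : IsInvPoch P U) (x : R) (n : ℕ) :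
    ∑ p ∈ Finset.HasAntidiagonal.antidiagonal n, (U p.1 * ∏ i ∈ Finset.range p.1, (1 - x * P ^ i)) *
      (x ^ p.2 * U p.2) = U n := by
  have h1 : E2 P U x * E1 U 1 * E1 U x = E1 U 1 := by
    rw [mul_right_comm, E2_mul_E1 h, one_mul]
  have h2 := congrArg (coeff n) h1
  rw [coeff_mul] at h2
  simp only [coeff_E2E1 h] at h2
  simpa [E1] using h2

end Domain

/-- substitution `y ↦ y²` -/
noncomputable def sqs (S : R⟦X⟧) : R⟦X⟧ :=
  PowerSeries.mk fun n => if Even n then coeff (n / 2) S else 0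

/-- pairs `(i,j)` with `i + 2 j = n` -/
def fib (n : ℕ) : Finset (ℕ × ℕ) :=
  (Finset.range (n / 2 + 1)).image fun j => (n - 2 * j, j)

theorem sum_fib {M : Type*} [AddCommMonoid M] (n : ℕ) (f : ℕ × ℕ → M) :
    ∑ p ∈ fib n, f p = ∑ j ∈ Finset.range (n / 2 + 1), f (n - 2 * j, j) := by
  rw [fib, Finset.sum_image]
  intro a _ b _ hab
  exact (Prod.ext_iff.1 hab).2

theorem mem_fib (n : ℕ) (p : ℕ × ℕ) : p ∈ fib n ↔ p.1 + 2 * p.2 = n := by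
  simp only [fib, Finset.mem_image, Finset.mem_range]
  constructor
  · rintro ⟨j, hj, rfl⟩; simp only; omega
  · rintro h; exact ⟨p.2, by omega, Prod.ext (by simp only; omega) rfl⟩

theorem coeff_mul_sq (A S : R⟦X⟧) (n : ℕ) :
    coeff n (A * sqs S) = ∑ p ∈ fib n, coeff p.1 A * coeff p.2 S := by
  rw [coeff_mul]
  simp only [sqs, coeff_mk, mul_ite, mul_zero]
  rw [← Finset.sum_filter]
  symm
  refine Finset.sum_bij' (fun p _ => (p.1, 2 * p.2)) (fun p _ => (p.1, p.2 / 2)) ?_ ?_ ?_ ?_ ?_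
  · intro p hp; rw [mem_fib] at hp; simp [hp]
  · intro p hp; simp only [Finset.mem_filter, Finset.HasAntidiagonal.mem_antidiagonal] at hp
    rw [mem_fib]; obtain ⟨h1, r, hr⟩ := hp; simp only; omega
  · intro p hp; simp
  · intro p hp; simp only [Finset.mem_filter, Finset.HasAntidiagonal.mem_antidiagonal] at hp
    obtain ⟨h1, r, hr⟩ := hp; ext <;> simp; omega
  · intro p hp; simp

theorem coeff_sq_even (S : R⟦X⟧) (n : ℕ) : coeff (2 * n) (sqs S) = coeff n S := by simp [sqs]
theorem coeff_sq_odd (S : R⟦X⟧) (n : ℕ) : coeff (2 * n + 1) (sqs S) = 0 := by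
  simp [sqs]

theorem sq_mul (A B : R⟦X⟧) : sqs (A * B) = sqs A * sqs B := by
  ext n
  rw [coeff_mul_sq, sum_fib]
  rcases Nat.even_or_odd' n with ⟨m, rfl | rfl⟩
  · rw [coeff_sq_even, coeff_mul, Finset.Nat.sum_antidiagonal_eq_sum_range_succ_mk,
      ← Finset.sum_range_reflect]
    rw [Nat.mul_div_cancel_left _ (by norm_num)]
    refine Finset.sum_congr rfl fun j hj => ?_
    rw [Finset.mem_range] at hj
    have : 2 * m - 2 * j = 2 * (m - j) := by omega
    have h2 : m - (m - j) = j := by omega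
    simp only [this, coeff_sq_even, Nat.add_sub_cancel, Nat.succ_eq_add_one, h2]
  · rw [coeff_sq_odd]
    symm
    refine Finset.sum_eq_zero fun j hj => ?_
    rw [Finset.mem_range] at hj
    have : 2 * m + 1 - 2 * j = 2 * (m - j) + 1 := by omega
    simp only [this, coeff_sq_odd, zero_mul]

section Domain2
variable [IsDomain R]

theorem E2_E2_neg {q : R} {u w : ℕ → R} (hu : IsInvPoch q u) (hw : IsInvPoch (q ^ 2) w) :
    E2 q u 1 * E2 q u (-1) = sqs (E2 (q ^ 2) w 1) := by
  set h := E2 q u 1 * E2 q u (-1) with hh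
  set h' := E2 q u (1 * q) * E2 q u (-1 * q) with hh'
  have hs : ∀ n, coeff n h' = q ^ n * coeff n h := by
    intro n
    simp only [hh, hh', coeff_mul, E2, coeff_mk, Finset.mul_sum]
    refine Finset.sum_congr rfl fun p hp => ?_
    rw [Finset.HasAntidiagonal.mem_antidiagonal] at hp
    rw [← hp]; ring
  have e : h = (1 - C (1 : R) * X) * ((1 - C (-1 : R) * X) * h') := by
    rw [hh, hh', E2_step hu 1, E2_step hu (-1)]; ring
  have c0 : coeff 0 h = 1 := by simp [hh, E2, tri, hu.zero]
  have c1 : coeff 1 h = 0 := by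
    have := congrArg (coeff (0 + 1)) e
    rw [coeff_succ_one_sub_mul, coeff_succ_one_sub_mul, coeff_zero_one_sub_mul, hs, hs] at this
    have ne := hu.ne 0
    apply mul_left_cancel₀ ne
    simp only [zero_add] at this ⊢
    linear_combination this
  have c2 : ∀ n, (1 - q ^ (n + 2)) * coeff (n + 2) h = - q ^ n * coeff n h := by
    intro n
    have := congrArg (coeff (n + 1 + 1)) e
    rw [coeff_succ_one_sub_mul, coeff_succ_one_sub_mul, coeff_succ_one_sub_mul, hs, hs, hs] at this
    linear_combination this
  ext n
  rcases Nat.even_or_odd' n with ⟨m, rfl | rfl⟩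
  · rw [coeff_sq_even]
    induction m with
    | zero => simpa [E2, tri, hw.zero] using c0
    | succ m ih =>
      have ne : (1 : R) - q ^ (2 * m + 2) ≠ 0 := by
        have := hu.ne (2 * m + 1); simpa [add_assoc] using this
      apply mul_left_cancel₀ ne
      have c := c2 (2 * m)
      have := hw.succ m
      rw [show 2 * (m + 1) = 2 * m + 2 by ring, c, ih]
      simp only [E2, coeff_mk, tri]
      rw [← this]; ring
  · rw [coeff_sq_odd]
    induction m with
    | zero => simpa using c1
    | succ m ih =>
      have ne : (1 : R) - q ^ (2 * m + 1 + 2) ≠ 0 := hu.ne (2 * m + 2)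
      apply mul_left_cancel₀ ne
      have c := c2 (2 * m + 1)
      rw [show 2 * (m + 1) + 1 = 2 * m + 1 + 2 by ring, c, ih]; simp

end Domain2

end Abstract

set_option linter.unusedSectionVars false

section Finite
variable {R : Type*} [CommRing R]

/-- `(q;q²)_n` -/
def po (q : R) (n : ℕ) : R := ∏ i ∈ Finset.range n, (1 - q ^ (2 * i + 1))

/-- `(q;q)_n` -/
def pq (q : R) (n : ℕ) : R := ∏ i ∈ Finset.range n, (1 - q ^ (i + 1))

theorem po_add (q : R) (e a : ℕ) :
    po q (e + a) = po q e * ∏ i ∈ Finset.range a, (1 - q ^ (2 * e + 1) * (q ^ 2) ^ i) := by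
  rw [po, Finset.prod_range_add, po]
  congr 1
  refine Finset.prod_congr rfl fun i _ => ?_
  ring

theorem pq_add (q : R) (e a : ℕ) :
    pq q (e + a) = pq q e * ∏ i ∈ Finset.range a, (1 - q ^ (e + 1) * q ^ i) := by
  rw [pq, Finset.prod_range_add, pq]
  congr 1
  refine Finset.prod_congr rfl fun i _ => ?_
  ring

theorem pq_mul_inv {q : R} {u : ℕ → R} (hu : IsInvPoch q u) (n : ℕ) : pq q n * u n = 1 := by
  induction n with
  | zero => simp [pq, hu.zero]
  | succ n ih =>
    rw [pq, Finset.prod_range_succ, ← pq, mul_assoc, hu.succ, ih]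

variable [IsDomain R]

theorem identI {q : R} {u w : ℕ → R} (hu : IsInvPoch q u) (hw : IsInvPoch (q ^ 2) w) (m n : ℕ) :
    ∑ p ∈ fib n, (-1) ^ p.2 * q ^ (tri p.1 + p.2 * (2 * m + 2 * p.1 + 3 * p.2)) *
      po q (m + p.1 + p.2) * u p.1 * w p.2 =
    ∑ p ∈ fib n, (-1) ^ p.2 * q ^ (2 * tri p.2) * po q (m + p.1 + p.2) * u p.1 * w p.2 := by
  set k := m + n with hk
  set E : R⟦X⟧ := PowerSeries.mk fun b => (-1) ^ b * q ^ (b * (2 * k - b)) * po q (k - b) * w b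
    with hE
  have hF : ∀ j, j ≤ k → coeff j (E2 (q ^ 2) w 1 * E) =
      (-1) ^ j * q ^ (2 * tri j) * po q (k - j) * w j := by
    intro j hj
    obtain ⟨e, he⟩ := Nat.exists_eq_add_of_le' hj
    have hc := chu hw (q ^ (2 * e + 1)) j
    rw [he, Nat.add_sub_cancel, ← hc, Finset.mul_sum, coeff_mul]
    refine Finset.sum_congr rfl fun p hp => ?_
    rw [Finset.HasAntidiagonal.mem_antidiagonal] at hp
    have h1 : k - p.2 = e + p.1 := by omega
    have h2 : p.2 * (2 * k - p.2) + 2 * tri p.1 = 2 * tri j + p.2 * (2 * e + 1) := by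
      have h3 : 2 * k - p.2 = 2 * e + 2 * p.1 + p.2 := by omega
      have := tri_two p.1
      have := tri_two j
      rw [h3]
      subst hp
      nlinarith
    simp only [hE, E2, coeff_mk, h1, po_add, one_pow, mul_one]
    have h4 : (q ^ 2) ^ tri p.1 * q ^ (p.2 * (2 * k - p.2)) =
        q ^ (2 * tri j) * (q ^ (2 * e + 1)) ^ p.2 := by
      rw [← pow_mul, ← pow_mul, ← pow_add, ← pow_add]
      congr 1; rw [add_comm, h2]; ring
    have h5 : (-1 : R) ^ p.1 * (-1) ^ p.2 = (-1) ^ j := by rw [← pow_add, hp]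
    rw [← h5]
    linear_combination ((-1) ^ p.1 * (-1) ^ p.2 * w p.1 * po q e *
      (∏ i ∈ Finset.range p.1, (1 - q ^ (2 * e + 1) * (q ^ 2) ^ i)) * w p.2) * h4
  have key : E2 q u (-1) * sqs E = E1 u 1 * sqs (E2 (q ^ 2) w 1 * E) := by
    rw [sq_mul, ← E2_E2_neg hu hw]
    have := E2_mul_E1 hu (1 : R)
    linear_combination (- E2 q u (-1) * sqs E) * this
  have := congrArg (coeff n) key
  rw [coeff_mul_sq, coeff_mul_sq] at this
  convert this using 1
  · refine Finset.sum_congr rfl fun p hp => ?_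
    rw [mem_fib] at hp
    have h1 : k - p.2 = m + p.1 + p.2 := by omega
    have h2 : 2 * k - p.2 = 2 * m + 2 * p.1 + 3 * p.2 := by omega
    simp only [hE, E2, coeff_mk, h1, h2]
    have h5 : (-1 : R) ^ p.1 * (-1) ^ p.1 = 1 := by rw [← mul_pow]; simp
    rw [pow_add]
    linear_combination (- (-1) ^ p.2 * q ^ tri p.1 * q ^ (p.2 * (2 * m + 2 * p.1 + 3 * p.2)) *
      po q (m + p.1 + p.2) * u p.1 * w p.2) * h5
  · refine Finset.sum_congr rfl fun p hp => ?_
    rw [mem_fib] at hp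
    rw [hF _ (by omega)]
    have h1 : k - p.2 = m + p.1 + p.2 := by omega
    simp only [E1, coeff_mk, h1, one_pow]
    ring

theorem coeff_prod_geom (x : R) (c : ℕ → R) (k : ℕ) : ∀ n, k ≤ n →
    coeff n ((∏ i ∈ Finset.range k, (1 - C (-c i) * X)) * PowerSeries.mk fun n => x ^ n) =
      x ^ (n - k) * ∏ i ∈ Finset.range k, (x + c i) := by
  induction k with
  | zero => intro n _; simp
  | succ k ih =>
    intro n hn
    obtain ⟨l, rfl⟩ := Nat.exists_eq_add_of_le' hn
    rw [Finset.prod_range_succ, mul_comm (∏ i ∈ Finset.range k, _), mul_assoc, ← add_assoc,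
      coeff_succ_one_sub_mul, ih _ (by omega), ih _ (by omega), Finset.prod_range_succ]
    rw [show l + k + 1 - k = l + 1 by omega, show l + k - k = l by omega,
      show l + k + 1 - (k + 1) = l by omega]
    ring

theorem E1_iter {q : R} {u : ℕ → R} (hu : IsInvPoch q u) (n : ℕ) :
    E1 u 1 * ∏ i ∈ Finset.range n, (1 - C (q ^ i) * X) = E1 u (q ^ n) := by
  induction n with
  | zero => simp
  | succ n ih =>
    rw [Finset.prod_range_succ, ← mul_assoc, ih, mul_comm, E1_step hu, pow_succ]

theorem IsInvPoch.map {q : R} {u : ℕ → R} (hu : IsInvPoch q u) :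
    IsInvPoch (C q : R⟦X⟧) (fun i => C (u i)) := by
  refine ⟨by simp [hu.zero], fun i => ?_, fun i h => hu.ne i ?_⟩
  · rw [← hu.succ i]; simp
  · rw [← map_pow, ← map_one C, ← map_sub] at h
    exact C_injective (by simpa using h)

theorem po_mul_pq_even {q : R} (n : ℕ) : po q n * pq (q ^ 2) n = pq q (2 * n) := by
  induction n with
  | zero => simp [po, pq]
  | succ n ih =>
    have e : pq q (2 * (n + 1)) = pq q (2 * n) * (1 - q ^ (2 * n + 1)) * (1 - q ^ (2 * n + 2)) := by
      rw [show 2 * (n + 1) = 2 * n + 1 + 1 by ring, pq, Finset.prod_range_succ,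
        Finset.prod_range_succ, ← pq]
    rw [e, ← ih]
    simp only [po, pq]
    rw [Finset.prod_range_succ, Finset.prod_range_succ]
    ring

theorem identE {q : R} {u w : ℕ → R} (hu : IsInvPoch q u) (hw : IsInvPoch (q ^ 2) w) (k : ℕ) :
    ∑ p ∈ fib k, (-1) ^ p.2 * q ^ (tri p.1 + p.1 + p.2 * (2 * p.1 + 3 * p.2)) *
      po q (p.1 + p.2) * u p.1 * w p.2 = q ^ (k * k) := by
  set A := E2 q u (q ^ (k + 1)) * E1 u 1 with hA
  set B : R⟦X⟧ := ∏ i ∈ Finset.range k, (1 - X ^ 2 * C (q ^ 2) ^ i) with hB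
  have hB' := coeff_E2E1 hw.map (X ^ 2 : R⟦X⟧) 1 k
  rw [coeff_mul] at hB'
  simp only [E1, E2, coeff_mk, one_pow, one_mul, ← hB] at hB'
  -- the product
  have hBB : B = (∏ i ∈ Finset.range k, (1 - C (q ^ i) * X)) *
      ∏ i ∈ Finset.range k, (1 - C (-q ^ i) * X) := by
    rw [hB, ← Finset.prod_mul_distrib]
    refine Finset.prod_congr rfl fun i _ => ?_
    simp only [map_neg, map_pow]; ring
  have hAB : (1 - C (q ^ k) * X) * (A * B) = ∏ i ∈ Finset.range k, (1 - C (-q ^ i) * X) := by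
    have h1 := E1_iter hu k
    have h2 := E1_step hu (q ^ k)
    have h3 := E2_mul_E1 hu (q ^ (k + 1))
    rw [pow_succ] at h3
    calc _ = E2 q u (q ^ (k + 1)) * ((1 - C (q ^ k) * X) * (E1 u 1 * ∏ i ∈ Finset.range k, (1 - C (q ^ i) * X))) * ∏ i ∈ Finset.range k, (1 - C (-q ^ i) * X) := by
            rw [hBB, hA]; ring
      _ = _ := by rw [h1, h2, pow_succ, h3, one_mul]
  have hS : A * B = (∏ i ∈ Finset.range k, (1 - C (-q ^ i) * X)) *
      PowerSeries.mk fun n => (q ^ k) ^ n := by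
    have hg : (1 - C (q ^ k) * X) * (PowerSeries.mk fun n => (q ^ k) ^ n) = 1 := by
      ext n
      cases n with
      | zero => rw [coeff_zero_one_sub_mul]; simp
      | succ n => rw [coeff_succ_one_sub_mul]; simp [coeff_one]; ring
    rw [← hAB]
    linear_combination (-(A * B)) * hg
  have hc := congrArg (coeff k) hS
  rw [coeff_prod_geom (q ^ k) (fun i => q ^ i) k k le_rfl, Nat.sub_self, pow_zero, one_mul] at hc
  -- the right-hand product
  have hr : ∀ k : ℕ, ∏ i ∈ Finset.range k, (q ^ k + q ^ i) =
      q ^ tri k * ∏ i ∈ Finset.range k, (1 + q ^ (i + 1)) := by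
    intro k
    rw [← Finset.prod_range_reflect (fun i => 1 + q ^ (i + 1))]
    have : q ^ tri k = ∏ i ∈ Finset.range k, q ^ i := by
      induction k with
      | zero => simp [tri]
      | succ k ih => rw [Finset.prod_range_succ, ← ih, tri, pow_add]
    rw [this, ← Finset.prod_mul_distrib]
    refine Finset.prod_congr rfl fun i hi => ?_
    rw [Finset.mem_range] at hi
    rw [mul_add, ← pow_add, mul_one, show i + (k - 1 - i + 1) = k by omega, add_comm]
  rw [hr] at hc
  have hneg : ∀ k : ℕ, pq q k * ∏ i ∈ Finset.range k, (1 + q ^ (i + 1)) = pq (q ^ 2) k := by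
    intro k
    rw [pq, pq, ← Finset.prod_mul_distrib]
    refine Finset.prod_congr rfl fun i _ => ?_
    ring
  -- the left-hand side
  have hl : ∑ p ∈ fib k, (-1) ^ p.2 * q ^ (tri p.1 + p.1 + p.2 * (2 * p.1 + 3 * p.2)) *
      po q (p.1 + p.2) * u p.1 * w p.2 = q ^ (tri k + k) * pq q k * w k * coeff k (A * B) := by
    have h7 : w k * coeff k (A * B) = coeff k (A * (C (w k) * B)) := by
      rw [mul_left_comm, coeff_C_mul]
    rw [mul_assoc _ (w k), h7, ← hB', Finset.mul_sum, map_sum,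
      Finset.Nat.sum_antidiagonal_eq_sum_range_succ_mk, sum_fib, Finset.mul_sum]
    refine Finset.sum_subset_zero_on_sdiff ?_ ?_ ?_
    · intro j hj; rw [Finset.mem_range] at *; omega
    · intro j hj
      rw [Finset.mem_sdiff, Finset.mem_range, Finset.mem_range] at hj
      rw [show A * ((-1) ^ j * C (q ^ 2) ^ tri j * (X ^ 2) ^ j * C (w j) * C (w (k - j))) =
        C ((-1) ^ j * (q ^ 2) ^ tri j * w j * w (k - j)) * (A * X ^ (2 * j)) by
          simp only [map_mul, map_pow, map_neg, map_one]; ring]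
      rw [coeff_C_mul, coeff_mul_X_pow', if_neg (by omega)]; simp
    · intro j hj
      rw [Finset.mem_range] at hj
      obtain ⟨i, hi⟩ : ∃ i, k = i + 2 * j := ⟨k - 2 * j, by omega⟩
      rw [show A * ((-1) ^ j * C (q ^ 2) ^ tri j * (X ^ 2) ^ j * C (w j) * C (w (k - j))) =
        C ((-1) ^ j * (q ^ 2) ^ tri j * w j * w (k - j)) * (A * X ^ (2 * j)) by
          simp only [map_mul, map_pow, map_neg, map_one]; ring]
      rw [coeff_C_mul, coeff_mul_X_pow', if_pos (by omega), hA, coeff_E2E1 hu]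
      rw [show k - 2 * j = i by omega, show k - j = i + j by omega]
      have hp1 := pq_add q k i
      have hp2 := po_mul_pq_even (q := q) (i + j)
      rw [show 2 * (i + j) = k + i by omega, hp1] at hp2
      have hp3 := pq_mul_inv hw (i + j)
      have hex : tri i + i + j * (2 * i + 3 * j) = tri k + k + 2 * tri j := by
        have := tri_two i
        have := tri_two j
        have := tri_two k
        subst hi
        nlinarith
      simp only
      rw [hex]
      have hpo : po q (i + j) = pq q k * (∏ l ∈ Finset.range i, (1 - q ^ (k + 1) * q ^ l)) *
          w (i + j) := by
        rw [← hp2, mul_assoc, hp3, mul_one]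
      rw [hpo]; ring
  rw [hl, hc]
  have h8 := hneg k
  have h9 := pq_mul_inv hw k
  have h10 : q ^ (k * k) = q ^ (tri k + k) * q ^ tri k := by
    rw [← pow_add]; congr 1; have := tri_two k; omega
  rw [h10]
  linear_combination (q ^ (tri k + k) * w k * q ^ tri k) * h8 + (q ^ (tri k + k) * q ^ tri k) * h9

end Finite

set_option linter.unusedSectionVars false

/-- The finite Jacobi triple product. -/
theorem finJTP {R : Type*} [CommRing R] [IsDomain R] {P a b : R} {U : ℕ → R}
    (h : IsInvPoch P U) (hab : a * b = P) (hP : P ≠ 0) (N : ℕ) :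
    U (2 * N) * ((∏ i ∈ Finset.range N, (1 - a * P ^ i)) * ∏ i ∈ Finset.range N, (1 - b * P ^ i)) =
      ∑ k ∈ Finset.range (N + 1), (-1) ^ k * b ^ k * P ^ tri k * (U (N + k) * U (N - k)) -
      ∑ k ∈ Finset.range N, (-1) ^ k * a ^ (k + 1) * P ^ tri (k + 1) *
        (U (N + k + 1) * U (N - k - 1)) := by
  have ha : a ≠ 0 := by rintro rfl; simp at hab; exact hP hab.symm
  have hq := coeff_E2E1 h a (P ^ N) (2 * N)
  have hprod : ∏ i ∈ Finset.range (2 * N), (P ^ N - a * P ^ i) =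
      ((-a) ^ N * P ^ (tri N + N * N)) *
       ((∏ i ∈ Finset.range N, (1 - a * P ^ i)) * ∏ i ∈ Finset.range N, (1 - b * P ^ i)) := by
    rw [two_mul, Finset.prod_range_add]
    have h1 : ∏ i ∈ Finset.range N, (P ^ N - a * P ^ i) =
        (-a) ^ N * P ^ tri N * ∏ i ∈ Finset.range N, (1 - b * P ^ i) := by
      have h2 : P ^ tri N = ∏ i ∈ Finset.range N, P ^ i := by
        clear hq
        induction N with
        | zero => simp [tri]
        | succ k ih => rw [Finset.prod_range_succ, ← ih, tri, pow_add]
      have h3 : (-a) ^ N = ∏ i ∈ Finset.range N, (-a) := by simp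
      rw [← Finset.prod_range_reflect (fun i => 1 - b * P ^ i), h2, h3, ← Finset.prod_mul_distrib,
        ← Finset.prod_mul_distrib]
      refine Finset.prod_congr rfl fun i hi => ?_
      rw [Finset.mem_range] at hi
      have h4 : P ^ N = P ^ i * (P * P ^ (N - 1 - i)) := by
        rw [← pow_succ', ← pow_add]; congr 1; omega
      rw [h4]
      nth_rewrite 2 [← hab]
      ring
    have h5 : ∏ i ∈ Finset.range N, (P ^ N - a * P ^ (N + i)) =
        P ^ (N * N) * ∏ i ∈ Finset.range N, (1 - a * P ^ i) := by
      have h3 : P ^ (N * N) = ∏ i ∈ Finset.range N, P ^ N := by simp [pow_mul]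
      rw [h3, ← Finset.prod_mul_distrib]
      refine Finset.prod_congr rfl fun i _ => ?_
      rw [pow_add]; ring
    rw [h1, h5, pow_add]; ring
  have hne : (-a) ^ N * P ^ (tri N + N * N) ≠ 0 :=
    mul_ne_zero (pow_ne_zero _ (neg_ne_zero.2 ha)) (pow_ne_zero _ hP)
  apply mul_left_cancel₀ hne
  rw [hprod] at hq
  rw [mul_left_comm, ← hq, coeff_mul, Finset.Nat.sum_antidiagonal_eq_sum_range_succ_mk,
    show (2 * N).succ = (N + 1) + N by omega]
  rw [Finset.sum_range_add, mul_sub, Finset.mul_sum, Finset.mul_sum, sub_eq_add_neg,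
    ← Finset.sum_neg_distrib]
  congr 1
  · rw [← Finset.sum_range_reflect]
    refine Finset.sum_congr rfl fun k hk => ?_
    rw [Finset.mem_range] at hk
    obtain ⟨l, rfl⟩ : ∃ l, N = l + k := ⟨N - k, by omega⟩
    simp only [E1, E2, coeff_mk]
    rw [show l + k + 1 - 1 - k = l by omega, show 2 * (l + k) - l = l + k + k by omega,
      show l + k - k = l by omega]
    have e1 : tri l + (l + k) * (l + k + k) = tri (l + k) + (l + k) * (l + k) + tri k + k := by
      have := tri_two l
      have := tri_two k
      have := tri_two (l + k)
      nlinarith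
    have e2 : P ^ tri l * (P ^ (l + k)) ^ (l + k + k) =
        P ^ (tri (l + k) + (l + k) * (l + k)) * P ^ tri k * P ^ k := by
      rw [← pow_mul, ← pow_add, e1]; ring
    have e3 : P ^ k = a ^ k * b ^ k := by rw [← hab, mul_pow]
    have e4 : (-1 : R) ^ k * (-1) ^ k = 1 := by rw [← mul_pow]; simp
    rw [neg_pow a]
    rw [e3] at e2
    rw [pow_add (-1 : R) l k, pow_add a l k]
    linear_combination ((-1) ^ l * a ^ l * U l * U (l + k + k)) * e2 -
      ((-1) ^ l * a ^ l * U l * U (l + k + k)) * (P ^ (tri (l + k) + (l + k) * (l + k)) * P ^ tri k * (a ^ k * b ^ k)) * e4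
  · refine Finset.sum_congr rfl fun k hk => ?_
    rw [Finset.mem_range] at hk
    obtain ⟨l, rfl⟩ : ∃ l, N = l + k + 1 := ⟨N - k - 1, by omega⟩
    simp only [E1, E2, coeff_mk]
    rw [show 2 * (l + k + 1) - (l + k + 1 + 1 + k) = l by omega,
      show l + k + 1 + 1 + k = l + k + 1 + (k + 1) by omega,
      show l + k + 1 - k - 1 = l by omega, ← add_assoc (l + k + 1) k 1]
    have e1 : tri (l + k + 1 + k + 1) + (l + k + 1) * l =
        tri (l + k + 1) + (l + k + 1) * (l + k + 1) + tri (k + 1) := by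
      have := tri_two (l + k + 1 + k + 1)
      have := tri_two (k + 1)
      have := tri_two (l + k + 1)
      nlinarith
    have e2 : P ^ tri (l + k + 1 + k + 1) * (P ^ (l + k + 1)) ^ l =
        P ^ (tri (l + k + 1) + (l + k + 1) * (l + k + 1)) * P ^ tri (k + 1) := by
      rw [← pow_mul, ← pow_add, e1]; ring
    rw [neg_pow a, show l + k + 1 + k + 1 = (l + k + 1) + (k + 1) by ring] at *
    rw [pow_add (-1 : R) (l + k + 1) (k + 1), pow_add a (l + k + 1) (k + 1)]
    linear_combination ((-1) ^ (l + k + 1) * (-1) ^ (k + 1) * a ^ (l + k + 1) * a ^ (k + 1) *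
      U l * U (l + k + 1 + (k + 1))) * e2

/-- inverse of `(X^M; X^M)_i` -/
noncomputable def UU (M i : ℕ) : ℤ⟦X⟧ :=
  ∏ j ∈ Finset.range i, PowerSeries.invOfUnit (1 - (X ^ M) ^ (j + 1)) 1

theorem one_sub_ne {M : ℕ} (hM : 0 < M) (i : ℕ) : (1 : ℤ⟦X⟧) - (X ^ M) ^ (i + 1) ≠ 0 := by
  intro h
  have := congrArg constantCoeff h
  simp [hM.ne'] at this

theorem UU_inv {M : ℕ} (hM : 0 < M) : IsInvPoch (X ^ M : ℤ⟦X⟧) (UU M) := by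
  refine ⟨by simp [UU], fun i => ?_, one_sub_ne hM⟩
  rw [UU, Finset.prod_range_succ, mul_left_comm, PowerSeries.mul_invOfUnit, mul_one, UU]
  simp [hM.ne']

theorem eq_of_dvd {f g : ℤ⟦X⟧} (h : ∀ D, X ^ D ∣ f - g) : f = g := by
  ext n
  have := X_pow_dvd_iff.1 (h (n + 1)) n (by omega)
  rw [map_sub] at this; linarith

theorem coeff_pochprod (e : ℤ) {c d : ℕ} (hc : 0 < c) (hd : 0 < d) (m n : ℕ) (h : m + 1 ≤ n) :
    coeff m (∏ i ∈ Finset.range n, (1 + C e * X ^ (c + d * i)) : ℤ⟦X⟧) =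
    coeff m (∏ i ∈ Finset.range (m + 1), (1 + C e * X ^ (c + d * i)) : ℤ⟦X⟧) := by
  induction n, h using Nat.le_induction with
  | base => rfl
  | succ n hn ih =>
    rw [Finset.prod_range_succ, mul_add, mul_one, map_add, ih, ← mul_assoc, coeff_mul_X_pow',
      if_neg, add_zero]
    nlinarith

theorem poch_cong (e : ℤ) {c d : ℕ} (hc : 0 < c) (hd : 0 < d) (D n : ℕ) (h : D ≤ n) :
    X ^ D ∣ pochInf e c d - ∏ i ∈ Finset.range n, (1 + C e * X ^ (c + d * i)) := by
  rw [X_pow_dvd_iff]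
  intro m hm
  rw [map_sub, coeff_pochprod e hc hd m n (by omega), pochInf, coeff_mk, sub_self]

theorem poch_limit (e : ℤ) {c d : ℕ} (hc : 0 < c) (hd : 0 < d) (F : ℕ → ℤ⟦X⟧)
    (hF : ∀ n, F n = (1 + C e * X ^ (c + d * n)) * F (n + 1)) (h1 : ∀ n, X ^ n ∣ F n - 1) :
    F 0 = pochInf e c d := by
  have h2 : ∀ n, F 0 = (∏ i ∈ Finset.range n, (1 + C e * X ^ (c + d * i))) * F n := by
    intro n
    induction n with
    | zero => simp
    | succ n ih => rw [ih, Finset.prod_range_succ, hF n, mul_assoc]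
  refine eq_of_dvd fun D => ?_
  have h3 := poch_cong e hc hd D D le_rfl
  have h4 := dvd_mul_of_dvd_right (h1 D) (∏ i ∈ Finset.range D, (1 + C e * X ^ (c + d * i)))
  have := dvd_sub h4 h3
  rw [h2 D]
  convert this using 1
  ring

/-- reduction modulo `X^D` -/
noncomputable abbrev red (D : ℕ) : ℤ⟦X⟧ →+* (ℤ⟦X⟧ ⧸ Ideal.span {(X : ℤ⟦X⟧) ^ D}) :=
  Ideal.Quotient.mk _

theorem red_eq {D : ℕ} {f g : ℤ⟦X⟧} : red D f = red D g ↔ X ^ D ∣ f - g := by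
  rw [Ideal.Quotient.eq, Ideal.mem_span_singleton]

theorem pq_prod (M n : ℕ) : pq (X ^ M : ℤ⟦X⟧) n =
    ∏ i ∈ Finset.range n, (1 + C (-1 : ℤ) * X ^ (M + M * i)) := by
  rw [pq]
  refine Finset.prod_congr rfl fun i _ => ?_
  rw [← pow_mul]; simp [mul_add, sub_eq_add_neg, add_comm]

/-- The `k`-th term of the theta series. -/
noncomputable def thetaTerm (t k : ℕ) : ℤ⟦X⟧ :=
  (-1) ^ k * ((X ^ (t + 1)) ^ k * (X ^ (t + 2)) ^ tri k - X ^ (k + 1) * (X ^ (t + 2)) ^ tri (k + 1))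

theorem jtp_cong (t D : ℕ) :
    X ^ D ∣ pochInf (-1) 1 (t + 2) * pochInf (-1) (t + 1) (t + 2) * pochInf (-1) (t + 2) (t + 2) -
      ∑ k ∈ Finset.range D, thetaTerm t k := by
  rw [← red_eq]
  have hU := UU_inv (M := t + 2) (by omega)
  set Q := pochInf (-1) (t + 2) (t + 2) with hQ
  set P : ℤ⟦X⟧ := X ^ (t + 2) with hP
  have key := finJTP (a := X) (b := X ^ (t + 1)) hU (by rw [← pow_succ']) (pow_ne_zero _ X_ne_zero)
    (2 * D)
  have hQn : ∀ n, D ≤ n → red D Q = red D (pq P n) := by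
    intro n hn
    rw [red_eq, pq_prod]
    exact poch_cong _ (by omega) (by omega) D n hn
  have hA : red D (pochInf (-1) 1 (t + 2)) = red D (∏ i ∈ Finset.range (2 * D), (1 - X * P ^ i)) := by
    rw [red_eq]
    convert poch_cong (-1) (c := 1) (d := t + 2) (by omega) (by omega) D (2 * D) (by omega) using 2
    refine Finset.prod_congr rfl fun i _ => ?_
    rw [pow_add, pow_one, ← pow_mul]; simp [sub_eq_add_neg]
  have hB : red D (pochInf (-1) (t + 1) (t + 2)) =
      red D (∏ i ∈ Finset.range (2 * D), (1 - X ^ (t + 1) * P ^ i)) := by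
    rw [red_eq]
    convert poch_cong (-1) (c := t + 1) (d := t + 2) (by omega) (by omega) D (2 * D) (by omega) using 2
    refine Finset.prod_congr rfl fun i _ => ?_
    rw [pow_add _ (t + 1), ← pow_mul]; simp [sub_eq_add_neg]
  have hone : ∀ a b, D ≤ a → D ≤ b →
      red D (Q * pq P (2 * (2 * D)) * (UU (t + 2) a * UU (t + 2) b)) = 1 := by
    intro a b ha hb
    rw [map_mul, map_mul, ← hQn _ (by omega), hQn a ha]
    nth_rewrite 2 [← hQn a ha]
    rw [hQn b hb, ← map_mul, ← map_mul, ← map_one (red D)]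
    congr 1
    have h1 := pq_mul_inv hU a
    have h2 := pq_mul_inv hU b
    linear_combination pq P b * UU (t + 2) b * h1 + h2
  have hz : ∀ (k : ℕ) (f : ℤ⟦X⟧), D ≤ k → X ^ k ∣ f → red D f = 0 := by
    intro k f hk hf
    rw [Ideal.Quotient.eq_zero_iff_mem, Ideal.mem_span_singleton]
    exact (pow_dvd_pow _ hk).trans hf
  have hAB : (∏ i ∈ Finset.range (2 * D), (1 - X * P ^ i)) *
      (∏ i ∈ Finset.range (2 * D), (1 - X ^ (t + 1) * P ^ i)) = pq P (2 * (2 * D)) *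
      (∑ k ∈ Finset.range (2 * D + 1), (-1) ^ k * (X ^ (t + 1)) ^ k * P ^ tri k *
        (UU (t + 2) (2 * D + k) * UU (t + 2) (2 * D - k)) -
      ∑ k ∈ Finset.range (2 * D), (-1) ^ k * X ^ (k + 1) * P ^ tri (k + 1) *
        (UU (t + 2) (2 * D + k + 1) * UU (t + 2) (2 * D - k - 1))) := by
    rw [← key, ← mul_assoc, pq_mul_inv hU, one_mul]
  have hlhs : red D (pochInf (-1) 1 (t + 2) * pochInf (-1) (t + 1) (t + 2) * Q) =
      red D (∑ k ∈ Finset.range (2 * D + 1), (-1) ^ k * (X ^ (t + 1)) ^ k * P ^ tri k *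
        (Q * pq P (2 * (2 * D)) * (UU (t + 2) (2 * D + k) * UU (t + 2) (2 * D - k)))) -
      red D (∑ k ∈ Finset.range (2 * D), (-1) ^ k * X ^ (k + 1) * P ^ tri (k + 1) *
        (Q * pq P (2 * (2 * D)) * (UU (t + 2) (2 * D + k + 1) * UU (t + 2) (2 * D - k - 1)))) := by
    rw [map_mul, map_mul, hA, hB, ← map_mul, hAB, ← map_mul, ← map_sub]
    congr 1
    rw [mul_comm, ← mul_assoc, mul_sub, Finset.mul_sum, Finset.mul_sum]
    congr 1 <;> refine Finset.sum_congr rfl fun k _ => ?_ <;> ring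
  rw [hlhs]
  simp only [thetaTerm, mul_sub, Finset.sum_sub_distrib]
  rw [map_sub, map_sum, map_sum, map_sum, map_sum]
  congr 1
  · symm
    refine Finset.sum_subset_zero_on_sdiff ?_ ?_ ?_
    · intro k hk; rw [Finset.mem_range] at *; omega
    · intro k hk
      rw [Finset.mem_sdiff, Finset.mem_range, Finset.mem_range] at hk
      refine hz k _ (by omega) ?_
      refine dvd_mul_of_dvd_left (dvd_mul_of_dvd_left (dvd_mul_of_dvd_right ?_ _) _) _
      rw [← pow_mul]; exact pow_dvd_pow _ (by nlinarith)
    · intro k hk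
      rw [Finset.mem_range] at hk
      rw [map_mul _ _ (Q * _ * _), hone _ _ (by omega) (by omega), mul_one, mul_assoc]
  · symm
    refine Finset.sum_subset_zero_on_sdiff ?_ ?_ ?_
    · intro k hk; rw [Finset.mem_range] at *; omega
    · intro k hk
      rw [Finset.mem_sdiff, Finset.mem_range, Finset.mem_range] at hk
      refine hz k _ (by omega) ?_
      refine dvd_mul_of_dvd_left (dvd_mul_of_dvd_left (dvd_mul_of_dvd_right ?_ _) _) _
      exact pow_dvd_pow _ (by omega)
    · intro k hk
      rw [Finset.mem_range] at hk
      rw [map_mul _ _ (Q * _ * _), hone _ _ (by omega) (by omega), mul_one, mul_assoc]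

open scoped PowerSeries.WithPiTopology

theorem summ {ι : Type*} [PartialOrder ι] [LocallyFiniteOrderBot ι] {f : ι → ℤ⟦X⟧} (φ : ι → ℕ)
    (h : ∀ i, X ^ φ i ∣ f i) (hb : ∀ D, ∃ b : ι, ∀ i, φ i < D → i ≤ b) : Summable f := by
  rw [PowerSeries.WithPiTopology.summable_iff_summable_coeff]
  intro n
  obtain ⟨b, hb⟩ := hb (n + 1)
  apply summable_of_hasFiniteSupport
  refine (Set.finite_Iic b).subset fun i hi => ?_
  apply hb
  by_contra hc
  exact hi (X_pow_dvd_iff.1 (h i) n (by omega))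

theorem summ1 {f : ℕ → ℤ⟦X⟧} (h : ∀ i, X ^ i ∣ f i) : Summable f :=
  summ id h fun D => ⟨D, fun i hi => by simp at hi; omega⟩

theorem summ2 {f : ℕ × ℕ → ℤ⟦X⟧} (h : ∀ i j, X ^ ((i - 1) + j) ∣ f (i, j)) : Summable f :=
  summ (fun p => (p.1 - 1) + p.2) (fun p => h p.1 p.2) fun D => ⟨(D + 1, D), fun i hi => by
    constructor <;> simp only <;> omega⟩

theorem summ3 {f : (ℕ × ℕ) × ℕ → ℤ⟦X⟧} (h : ∀ i j s, X ^ (i + j + s) ∣ f ((i, j), s)) : Summable f :=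
  summ (fun p => p.1.1 + p.1.2 + p.2) (fun p => h p.1.1 p.1.2 p.2) fun D => ⟨((D, D), D), fun i hi => by
    refine ⟨⟨?_, ?_⟩, ?_⟩ <;> simp only <;> omega⟩

theorem coeff_tsum {ι : Type*} {f : ι → ℤ⟦X⟧} (hf : Summable f) (n : ℕ) :
    HasSum (fun i => coeff n (f i)) (coeff n (∑' i, f i)) :=
  (PowerSeries.WithPiTopology.hasSum_iff_hasSum_coeff ℤ |>.1 hf.hasSum) n

theorem dvd_tsum {ι : Type*} {f : ι → ℤ⟦X⟧} (hf : Summable f) (D : ℕ) (h : ∀ i, X ^ D ∣ f i) :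
    X ^ D ∣ ∑' i, f i := by
  rw [X_pow_dvd_iff]
  intro n hn
  have h1 := coeff_tsum hf n
  have h2 : (fun i => coeff n (f i)) = fun _ => 0 := by
    funext i; exact X_pow_dvd_iff.1 (h i) n hn
  rw [h2] at h1
  exact h1.unique hasSum_zero

theorem tsum_cong {f : ℕ → ℤ⟦X⟧} (h : ∀ i, X ^ i ∣ f i) (D : ℕ) :
    X ^ D ∣ ∑' i, f i - ∑ i ∈ Finset.range D, f i := by
  have := (summ1 h).sum_add_tsum_nat_add D
  rw [← this, add_sub_cancel_left]
  exact dvd_tsum ((summable_nat_add_iff D).2 (summ1 h)) D fun i =>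
    (pow_dvd_pow _ (by omega)).trans (h (i + D))

/-- `q`-series `∑ (-1)^i q^(i(i+1)/2 + l i) / (q;q)_i` -/
noncomputable def phiT (l i : ℕ) : ℤ⟦X⟧ := (-1) ^ i * X ^ (tri i + i + l * i) * UU 1 i
noncomputable def Phi (l : ℕ) : ℤ⟦X⟧ := ∑' i, phiT l i

theorem hu1 : IsInvPoch (X : ℤ⟦X⟧) (UU 1) := by
  have := UU_inv (M := 1) one_pos; rwa [pow_one] at this
theorem hw2 : IsInvPoch (X ^ 2 : ℤ⟦X⟧) (UU 2) := UU_inv (M := 2) two_pos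

theorem phiT_dvd (l i : ℕ) : X ^ i ∣ phiT l i :=
  Dvd.dvd.mul_right (Dvd.dvd.mul_left (pow_dvd_pow _ (by omega)) _) _

theorem Phi_step (l : ℕ) : Phi l = (1 - X ^ (l + 1)) * Phi (l + 1) := by
  have h0 := summ1 (phiT_dvd l)
  have h1 := summ1 (phiT_dvd (l + 1))
  have e : Phi l - Phi (l + 1) = - X ^ (l + 1) * Phi (l + 1) := by
    rw [Phi, Phi, ← h0.tsum_sub h1, (h0.sub h1).tsum_eq_zero_add, ← h1.tsum_mul_left]
    have : phiT l 0 - phiT (l + 1) 0 = 0 := by simp [phiT, tri]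
    rw [this, zero_add]
    refine tsum_congr fun i => ?_
    have := hu1.succ i
    simp only [phiT, tri]
    rw [← this]
    ring
  linear_combination e

theorem Phi_one (l : ℕ) : X ^ l ∣ Phi l - 1 := by
  have h0 := summ1 (phiT_dvd l)
  rw [Phi, h0.tsum_eq_zero_add]
  have : phiT l 0 = 1 := by simp [phiT, tri, UU]
  rw [this, add_sub_cancel_left]
  exact dvd_tsum ((summable_nat_add_iff 1).2 h0) l fun i =>
    Dvd.dvd.mul_right (Dvd.dvd.mul_left (pow_dvd_pow _ (by nlinarith)) _) _

theorem Phi_zero : Phi 0 = pochInf (-1) 1 1 := by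
  refine poch_limit (-1) one_pos one_pos Phi (fun n => ?_) Phi_one
  rw [Phi_step]; simp [sub_eq_add_neg, add_comm]

theorem Phi_eq (l : ℕ) : Phi l = pochInf (-1) 1 1 * UU 1 l := by
  rw [← Phi_zero]
  induction l with
  | zero => simp [UU]
  | succ l ih =>
    have h1 := Phi_step l
    have h2 := hu1.succ l
    apply mul_left_cancel₀ (hu1.ne l)
    rw [← h1, ih, ← h2]; ring

noncomputable def psiT (l s : ℕ) : ℤ⟦X⟧ := X ^ ((2 * l + 1) * s) * UU 2 s
noncomputable def Psi (l : ℕ) : ℤ⟦X⟧ := ∑' i, psiT l i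

theorem psiT_dvd (l i : ℕ) : X ^ i ∣ psiT l i :=
  Dvd.dvd.mul_right (pow_dvd_pow _ (by nlinarith)) _

theorem Psi_step (l : ℕ) : Psi (l + 1) = (1 - X ^ (2 * l + 1)) * Psi l := by
  have h0 := summ1 (psiT_dvd l)
  have h1 := summ1 (psiT_dvd (l + 1))
  have e : Psi l - Psi (l + 1) = X ^ (2 * l + 1) * Psi l := by
    rw [Psi, Psi, ← h0.tsum_sub h1, (h0.sub h1).tsum_eq_zero_add, ← h0.tsum_mul_left]
    have : psiT l 0 - psiT (l + 1) 0 = 0 := by simp [psiT]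
    rw [this, zero_add]
    refine tsum_congr fun i => ?_
    have := hw2.succ i
    simp only [psiT]
    rw [← this]
    ring
  linear_combination -e

theorem Psi_eq (l : ℕ) : Psi l = Psi 0 * po X l := by
  induction l with
  | zero => simp [po]
  | succ l ih => rw [Psi_step, ih, po, po, Finset.prod_range_succ]; ring

theorem Psi_one (l : ℕ) : X ^ l ∣ Psi l - 1 := by
  have h0 := summ1 (psiT_dvd l)
  rw [Psi, h0.tsum_eq_zero_add]
  have : psiT l 0 = 1 := by simp [psiT, UU]
  rw [this, add_sub_cancel_left]
  exact dvd_tsum ((summable_nat_add_iff 1).2 h0) l fun i =>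
    Dvd.dvd.mul_right (pow_dvd_pow _ (by nlinarith)) _

theorem po_fin (n : ℕ) : po X n * (∏ i ∈ Finset.range (2 * n), (1 + X ^ (i + 1))) * pq (X ^ 2) n =
    (pq (X ^ 2) (2 * n) : ℤ⟦X⟧) := by
  have h := po_mul_pq_even (q := (X : ℤ⟦X⟧)) n
  rw [mul_right_comm, h, pq, pq, ← Finset.prod_mul_distrib]
  refine Finset.prod_congr rfl fun i _ => ?_
  rw [← pow_mul]; ring

theorem Psi_zero : Psi 0 = pochInf 1 1 1 := by
  refine eq_of_dvd fun D => ?_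
  rw [← red_eq]
  have hA : red D (pochInf 1 1 1) = red D (∏ i ∈ Finset.range (2 * D), (1 + X ^ (i + 1))) := by
    rw [red_eq]
    convert poch_cong 1 (c := 1) (d := 1) one_pos one_pos D (2 * D) (by omega) using 2
    refine Finset.prod_congr rfl fun i _ => ?_
    simp [add_comm]
  have hq : ∀ n, D ≤ n → red D (pochInf (-1) 2 2) = red D (pq (X ^ 2) n) := by
    intro n hn
    rw [red_eq, pq_prod]
    exact poch_cong _ (by omega) (by omega) D n hn
  have h1 := congrArg (red D) (po_fin D)
  have h2 := congrArg (red D) (Psi_eq D)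
  have h3 := (red_eq (D := D)).2 (Psi_one D)
  have h4 := congrArg (red D) (pq_mul_inv hw2 D)
  simp only [map_mul, map_one] at h1 h2 h3 h4
  rw [← hq (2 * D) (by omega), hq D le_rfl, ← hA] at h1
  rw [h3] at h2
  have h5 : red D (po X D) * red D (pochInf 1 1 1) = 1 := by
    linear_combination red D (UU 2 D) * h1 + (1 - red D (po X D) * red D (pochInf 1 1 1)) * h4
  linear_combination (-red D (Psi 0)) * h5 - red D (pochInf 1 1 1) * h2

open scoped PowerSeries.WithPiTopology

theorem tsum_fib {f : ℕ × ℕ → ℤ⟦X⟧} (hf : Summable f) :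
    HasSum (fun n => ∑ p ∈ fib n, f p) (∑' p, f p) := by
  have h := hf.hasSum.tsum_fiberwise (fun p : ℕ × ℕ => p.1 + 2 * p.2)
  have he : (fun n => ∑ p ∈ fib n, f p) =
      fun n => ∑' b : ((fun p : ℕ × ℕ => p.1 + 2 * p.2) ⁻¹' {n}), f b := by
    funext n
    have e : (fun p : ℕ × ℕ => p.1 + 2 * p.2) ⁻¹' {n} = ↑(fib n) := by
      ext p; simp [mem_fib]
    rw [e]
    exact (Finset.tsum_subtype (fib n) f).symm
  rw [he]
  exact h

noncomputable def hT (m a r : ℕ) (p : ℕ × ℕ) : ℤ⟦X⟧ :=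
  (-1) ^ (p.1 + p.2) * X ^ (a * ((p.1 + 2 * p.2) * m + tri (p.1 + 2 * p.2) + (p.1 + 2 * p.2)) +
    tri p.1 + p.1 * r + p.2 * (2 * m + 2 * p.1 + 3 * p.2)) *
    (1 - X ^ (2 * (m + p.1 + 2 * p.2) + 1)) * Psi (m + p.1 + p.2) * UU 1 p.1 * UU 2 p.2

noncomputable def hh (m a r : ℕ) : ℤ⟦X⟧ := ∑' p, hT m a r p

theorem tri_ge (i : ℕ) : i - 1 ≤ tri i := by
  have := tri_two i
  rcases i with _ | _ | i
  · simp
  · simp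
  · simp only [Nat.add_sub_cancel]; nlinarith

theorem hT_summ (m a r : ℕ) : Summable (hT m a r) := by
  refine summ2 fun i j => ?_
  unfold hT
  refine Dvd.dvd.mul_right (Dvd.dvd.mul_right (Dvd.dvd.mul_right (Dvd.dvd.mul_right
    (Dvd.dvd.mul_left (pow_dvd_pow _ ?_) _) _) _) _) _
  have := tri_ge i
  have : j ≤ j * (2 * m + 2 * i + 3 * j) := by
    rcases j with _ | j
    · simp
    · exact Nat.le_mul_of_pos_right _ (by omega)
  simp only
  omega

theorem R1 (m a r : ℕ) : hh m a (r + 1) = hh m a r + X ^ ((m + 1) * a + r) * hh (m + 1) a (r + 1) := by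
  have h0 := hT_summ m a r
  have h1 := hT_summ m a (r + 1)
  have e : hh m a (r + 1) - hh m a r = X ^ ((m + 1) * a + r) * hh (m + 1) a (r + 1) := by
    rw [hh, hh, ← h1.tsum_sub h0, hh, ← (hT_summ (m + 1) a (r + 1)).tsum_mul_left]
    have hinj : Function.Injective (fun p : ℕ × ℕ => (p.1 + 1, p.2)) := by
      intro p p' h; simp only [Prod.mk.injEq] at h; ext <;> omega
    rw [← hinj.tsum_eq]
    · refine tsum_congr fun p => ?_
      obtain ⟨i, j⟩ := p
      have := hu1.succ i
      simp only [hT]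
      rw [← this, show i + 1 + 2 * j = (i + 2 * j) + 1 by ring, tri, tri,
        show m + 1 + i + j = m + (i + 1) + j by ring, show m + 1 + i + 2 * j = m + (i + 1) + 2 * j by ring]
      ring
    · intro p hp
      obtain ⟨i, j⟩ := p
      rcases i with _ | i
      · exfalso; apply hp; simp [hT]
      · exact ⟨(i, j), rfl⟩
  linear_combination e

theorem sgn (i j n : ℕ) (h : i + 2 * j = n) : (-1 : ℤ⟦X⟧) ^ (i + j) = (-1) ^ n * (-1) ^ j := by
  rw [← h, ← pow_add, show i + 2 * j + j = i + j + 2 * j by ring, pow_add _ (i + j), pow_mul]; simp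

theorem R2 (m a : ℕ) : hh m (a + 1) 0 = hh m a (m + 1) := by
  have h0 := tsum_fib (hT_summ m (a + 1) 0)
  have h1 := tsum_fib (hT_summ m a (m + 1))
  rw [hh, hh]
  refine h0.unique ?_
  convert h1 using 2 with n
  have key := identI hu1 hw2 m n
  have := congrArg (fun z => (-1) ^ n * X ^ (a * (n * m + tri n + n)) * X ^ (n * m + tri n + n) *
    (1 - X ^ (2 * (m + n) + 1)) * Psi 0 * z) key
  simp only [Finset.mul_sum] at this
  convert this using 1
  · refine Finset.sum_congr rfl fun p hp => ?_
    rw [mem_fib] at hp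
    obtain ⟨i, j⟩ := p
    simp only at hp
    simp only [hT, sgn i j n hp, Psi_eq (m + i + j), hp, show m + i + 2 * j = m + n by omega]
    ring
  · refine Finset.sum_congr rfl fun p hp => ?_
    rw [mem_fib] at hp
    obtain ⟨i, j⟩ := p
    simp only at hp
    have e : tri i + i * (m + 1) + j * (2 * m + 2 * i + 3 * j) = (n * m + tri n + n) + 2 * tri j := by
      have := tri_two i
      have := tri_two j
      have := tri_two n
      subst hp; nlinarith
    simp only [hT, sgn i j n hp, Psi_eq (m + i + j), hp, show m + i + 2 * j = m + n by omega]
    rw [add_assoc, add_assoc, ← add_assoc (tri i), e]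
    ring

theorem theta_eq (t k : ℕ) : thetaTerm t k =
    (-1) ^ k * X ^ (t * (tri k + k) + k * k) * (1 - X ^ (2 * k + 1)) := by
  have h1 : t * (tri k + k) + k * k = (t + 1) * k + (t + 2) * tri k := by
    have := tri_two k
    nlinarith
  have h2 : t * (tri k + k) + k * k + (2 * k + 1) = (k + 1) + (t + 2) * tri (k + 1) := by
    have := tri_two k
    simp only [tri]
    nlinarith
  have h3 : (X : ℤ⟦X⟧) ^ (t * (tri k + k) + k * k) * (1 - X ^ (2 * k + 1)) =
      X ^ ((t + 1) * k + (t + 2) * tri k) - X ^ ((k + 1) + (t + 2) * tri (k + 1)) := by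
    rw [mul_sub, mul_one, ← pow_add, h2, h1]
  rw [thetaTerm, mul_assoc, h3, ← pow_mul, ← pow_mul, ← pow_add, ← pow_mul, ← pow_add]

theorem eval_term (t n : ℕ) : ∑ p ∈ fib n, hT 0 t 1 p = Psi 0 * thetaTerm t n := by
  have key := identE hu1 hw2 n
  rw [theta_eq, pow_add, ← key, Finset.mul_sum, Finset.mul_sum, Finset.sum_mul, Finset.mul_sum]
  refine Finset.sum_congr rfl fun p hp => ?_
  rw [mem_fib] at hp
  obtain ⟨i, j⟩ := p
  simp only at hp
  simp only [hT, sgn i j n hp, zero_add, hp]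
  rw [Psi_eq (i + j)]
  ring

theorem theta_dvd (t k : ℕ) : X ^ k ∣ thetaTerm t k := by
  rw [theta_eq]
  exact Dvd.dvd.mul_right (Dvd.dvd.mul_left (pow_dvd_pow _ (by have := Nat.le_mul_self k; omega)) _) _

theorem eval (t : ℕ) : hh 0 t 1 = pochInf 1 1 1 *
    (pochInf (-1) 1 (t + 2) * pochInf (-1) (t + 1) (t + 2) * pochInf (-1) (t + 2) (t + 2)) := by
  have h0 := tsum_fib (hT_summ 0 t 1)
  simp only [eval_term] at h0
  have h1 := (summ1 (theta_dvd t)).hasSum.mul_left (Psi 0)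
  rw [hh, h0.unique h1, Psi_zero]
  congr 1
  refine eq_of_dvd fun D => ?_
  have h2 := tsum_cong (theta_dvd t) D
  have h3 := jtp_cong t D
  have := dvd_sub h2 h3
  rwa [sub_sub_sub_cancel_right] at this

open scoped PowerSeries.WithPiTopology

theorem hs_congr {f g : ℕ → ℤ⟦X⟧} {a b : ℤ⟦X⟧} (h : HasSum f a) (hg : ∀ i, g i = f i)
    (hb : b = a) : HasSum g b := by
  rw [hb, funext hg]; exact h

theorem tsum_anti {f : ℕ × ℕ → ℤ⟦X⟧} (hf : Summable f) :
    HasSum (fun n => ∑ p ∈ Finset.HasAntidiagonal.antidiagonal n, f p) (∑' p, f p) := by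
  have h := hf.hasSum.tsum_fiberwise (fun p : ℕ × ℕ => p.1 + p.2)
  have he : (fun n => ∑ p ∈ Finset.HasAntidiagonal.antidiagonal n, f p) =
      fun n => ∑' b : ((fun p : ℕ × ℕ => p.1 + p.2) ⁻¹' {n}), f b := by
    funext n
    have e : (fun p : ℕ × ℕ => p.1 + p.2) ⁻¹' {n} = ↑(Finset.HasAntidiagonal.antidiagonal n) := by
      ext p; simp
    rw [e]
    exact (Finset.tsum_subtype (Finset.HasAntidiagonal.antidiagonal n) f).symm
  rw [he]
  exact h

noncomputable def bT (m i j s : ℕ) : ℤ⟦X⟧ :=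
  (-1) ^ (i + j) * X ^ (tri i + i + j * (2 * m + 2 * i + 3 * j) + (2 * (m + i + j) + 1) * s) *
    (1 - X ^ (2 * (m + i + 2 * j) + 1)) * UU 1 i * UU 2 j * UU 2 s

theorem bT_dvd (m i j s : ℕ) : X ^ (i + j + s) ∣ bT m i j s := by
  unfold bT
  refine Dvd.dvd.mul_right (Dvd.dvd.mul_right (Dvd.dvd.mul_right (Dvd.dvd.mul_right
    (Dvd.dvd.mul_left (pow_dvd_pow _ ?_) _) _) _) _) _
  have h1 : j ≤ j * (2 * m + 2 * i + 3 * j) := by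
    rcases j with _ | j
    · simp
    · exact Nat.le_mul_of_pos_right _ (by omega)
  have h2 : s ≤ (2 * (m + i + j) + 1) * s := Nat.le_mul_of_pos_left _ (by omega)
  omega

noncomputable def cT (m : ℕ) (p : ℕ × ℕ) : ℤ⟦X⟧ :=
  (-1) ^ p.1 * X ^ ((2 * m + 1) * (p.1 + p.2) + 2 * p.1 * (p.1 + p.2) + 2 * tri p.1) * UU 2 p.1 * UU 2 p.2 *
    (Phi (2 * (p.1 + p.2)) - X ^ (2 * m + 4 * p.1 + 1) * Phi (2 * (p.1 + p.2) + 2))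

theorem bT_inner (m j s : ℕ) : HasSum (fun i => bT m i j s) (cT m (j, s)) := by
  have h0 := (summ1 (phiT_dvd (2 * (j + s)))).hasSum
  have h1 := (summ1 (phiT_dvd (2 * (j + s) + 2))).hasSum.mul_left (X ^ (2 * m + 4 * j + 1))
  have h2 := (h0.sub h1).mul_left ((-1) ^ j * X ^ ((2 * m + 1) * (j + s) + 2 * j * (j + s) + 2 * tri j)
    * UU 2 j * UU 2 s)
  refine hs_congr h2 (fun i => ?_) rfl
  simp only [bT, phiT]
  have e : tri i + i + j * (2 * m + 2 * i + 3 * j) + (2 * (m + i + j) + 1) * s =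
     ((2 * m + 1) * (j + s) + 2 * j * (j + s) + 2 * tri j) + (tri i + i + 2 * (j + s) * i) := by
    have := tri_two j
    nlinarith
  rw [e]
  ring

theorem cT_summ (m : ℕ) : Summable (cT m) := by
  refine summ2 fun j s => ?_
  unfold cT
  refine Dvd.dvd.mul_right (Dvd.dvd.mul_right (Dvd.dvd.mul_right 
    (Dvd.dvd.mul_left (pow_dvd_pow _ ?_) _) _) _) _
  have h2 : j + s ≤ (2 * m + 1) * (j + s) := Nat.le_mul_of_pos_left _ (by omega)
  simp only
  omega

noncomputable def al (m N : ℕ) : ℤ⟦X⟧ := X ^ ((2 * m + 1) * N) * UU 2 N * UU 1 (2 * N) *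
  ∏ i ∈ Finset.range N, (1 - X ^ (2 * N) * (X ^ 2) ^ i)

theorem cT_anti (m N : ℕ) : ∑ p ∈ Finset.HasAntidiagonal.antidiagonal N, cT m p =
    pochInf (-1) 1 1 * (al m N - al m (N + 1)) := by
  have k1 := coeff_E2E1 hw2 (X ^ (2 * N)) 1 N
  have k2 := coeff_E2E1 hw2 (X ^ (2 * N + 4)) 1 N
  rw [coeff_mul] at k1 k2
  simp only [E1, E2, coeff_mk, one_pow, one_mul] at k1 k2
  have e2 : al m (N + 1) = X ^ ((2 * m + 1) * (N + 1)) * UU 1 (2 * N + 2) *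
      (UU 2 N * ∏ i ∈ Finset.range N, (1 - X ^ (2 * N + 4) * (X ^ 2) ^ i)) := by
    rw [al, Finset.prod_range_succ', ← hw2.succ N]
    have : ∀ i, (X : ℤ⟦X⟧) ^ (2 * (N + 1)) * (X ^ 2) ^ (i + 1) = X ^ (2 * N + 4) * (X ^ 2) ^ i := by
      intro i; ring
    simp only [this]
    ring
  rw [e2, ← k2]
  have e1 : al m N = X ^ ((2 * m + 1) * N) * UU 1 (2 * N) *
      (UU 2 N * ∏ i ∈ Finset.range N, (1 - X ^ (2 * N) * (X ^ 2) ^ i)) := by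
    rw [al]; ring
  rw [e1, ← k1, Finset.mul_sum, Finset.mul_sum, ← Finset.sum_sub_distrib, Finset.mul_sum]
  refine Finset.sum_congr rfl fun p hp => ?_
  rw [Finset.HasAntidiagonal.mem_antidiagonal] at hp
  simp only [cT, hp, Phi_eq]
  ring

theorem al_dvd (m N : ℕ) : X ^ N ∣ al m N := by
  unfold al
  refine Dvd.dvd.mul_right (Dvd.dvd.mul_right (Dvd.dvd.mul_right (pow_dvd_pow _ ?_) _) _) _
  exact Nat.le_mul_of_pos_left _ (by omega)

theorem boundary (m : ℕ) : hh m 0 1 = pochInf (-1) 1 1 := by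
  have hS : Summable (fun p : (ℕ × ℕ) × ℕ => bT m p.1.1 p.1.2 p.2) :=
    summ3 fun i j s => bT_dvd m i j s
  have hin : ∀ p : ℕ × ℕ, HasSum (fun s => bT m p.1 p.2 s) (hT m 0 1 p) := by
    rintro ⟨i, j⟩
    have h0 := (summ1 (psiT_dvd (m + i + j))).hasSum.mul_left ((-1) ^ (i + j) *
      X ^ (tri i + i + j * (2 * m + 2 * i + 3 * j)) * (1 - X ^ (2 * (m + i + 2 * j) + 1)) *
      UU 1 i * UU 2 j)
    refine hs_congr h0 (fun s => ?_) ?_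
    · simp only [bT, psiT]; ring
    · simp only [hT, Psi]; ring_nf
  have h1 : ∑' p : (ℕ × ℕ) × ℕ, bT m p.1.1 p.1.2 p.2 = hh m 0 1 := by
    rw [hS.tsum_prod' fun p => (hin p).summable, hh]
    exact tsum_congr fun p => (hin p).tsum_eq
  let e : (ℕ × ℕ) × ℕ ≃ (ℕ × ℕ) × ℕ :=
    ⟨fun p => ((p.2, p.1.1), p.1.2), fun p => ((p.1.2, p.2), p.1.1), fun _ => rfl, fun _ => rfl⟩
  have h2 : ∑' p : (ℕ × ℕ) × ℕ, bT m p.1.1 p.1.2 p.2 = ∑' p, cT m p := by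
    have hS' : Summable (fun p : (ℕ × ℕ) × ℕ => bT m p.2 p.1.1 p.1.2) := by
      refine summ3 fun j s i => ?_
      have := bT_dvd m i j s
      rwa [show j + s + i = i + j + s by ring]
    have h6 : ∑' p : (ℕ × ℕ) × ℕ, bT m p.2 p.1.1 p.1.2 =
        ∑' p : (ℕ × ℕ) × ℕ, bT m p.1.1 p.1.2 p.2 :=
      e.tsum_eq (fun p : (ℕ × ℕ) × ℕ => bT m p.1.1 p.1.2 p.2)
    rw [← h6, hS'.tsum_prod' fun p => (bT_inner m p.1 p.2).summable]
    exact tsum_congr fun p => (bT_inner m p.1 p.2).tsum_eq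
  rw [← h1, h2]
  have h3 := tsum_anti (cT_summ m)
  simp only [cT_anti] at h3
  have h4 := summ1 (al_dvd m)
  have h5 := (h4.hasSum.sub ((summable_nat_add_iff 1).2 h4).hasSum).mul_left (pochInf (-1) 1 1)
  rw [h3.unique h5, h4.tsum_eq_zero_add, add_sub_cancel_right]
  simp [al, UU]

noncomputable def HH (m c : ℕ) : ℤ⟦X⟧ := hh m (c / (m + 1)) (c % (m + 1) + 1)

theorem HH_zero (m : ℕ) : HH m 0 = pochInf (-1) 1 1 := by
  rw [HH, Nat.zero_div, Nat.zero_mod, zero_add, boundary]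

theorem HH_val (m a r : ℕ) (hr : r < m + 1) : HH m ((m + 1) * a + r) = hh m a (r + 1) := by
  rw [HH, Nat.mul_add_div (by omega), Nat.mul_add_mod, Nat.div_eq_of_lt hr, Nat.mod_eq_of_lt hr,
    add_zero]

theorem HH_succ (m c : ℕ) : HH m (c + 1) = HH m c + X ^ (c + 1) * HH (m + 1) ((c + 1) * (m + 2) / (m + 1)) := by
  obtain ⟨a, r, hr, hc⟩ : ∃ a r, r < m + 1 ∧ c + 1 = (m + 1) * a + r :=
    ⟨(c + 1) / (m + 1), (c + 1) % (m + 1), Nat.mod_lt _ (by omega), (Nat.div_add_mod _ _).symm⟩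
  have h1 : (c + 1) * (m + 2) / (m + 1) = (m + 1 + 1) * a + r := by
    rw [hc, show ((m + 1) * a + r) * (m + 2) = (m + 1) * ((m + 2) * a + r) + r by ring,
      Nat.mul_add_div (by omega), Nat.div_eq_of_lt hr]
    ring
  rw [h1, HH_val (m + 1) a r (by omega), hc, HH_val m a r hr]
  rcases r with _ | r
  · rcases a with _ | a
    · omega
    · have : c = (m + 1) * a + m := by rw [mul_add] at hc; omega
      rw [this, HH_val m a m (by omega), R1 m (a + 1) 0, R2]
  · have : c = (m + 1) * a + r := by omega
    rw [this, HH_val m a r (by omega), R1 m a (r + 1)]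

/-- list version of anti-lecture hall compositions, read from the last part -/
def Pl : ℕ → ℕ → List ℕ → Prop
  | _, _, [] => True
  | m, c, x :: l => 0 < x ∧ x ≤ c ∧ Pl (m + 1) (x * (m + 2) / (m + 1)) l

def AA (m c N : ℕ) : Set (List ℕ) := {l | Pl m c l ∧ l.sum = N}

theorem AA_zero (m N : ℕ) : AA m 0 N = if N = 0 then {[]} else ∅ := by
  ext l
  rcases l with _ | ⟨x, l⟩
  · split_ifs with h
    · simp [AA, Pl, h]
    · simp [AA, Pl, Ne.symm h]
  · split_ifs with h
    · simp [AA, Pl]; omega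
    · simp [AA, Pl]; omega

theorem AA_succ (m c N : ℕ) : AA m (c + 1) N = AA m c N ∪
    if c + 1 ≤ N then (List.cons (c + 1)) '' AA (m + 1) ((c + 1) * (m + 2) / (m + 1)) (N - (c + 1)) else ∅ := by
  ext l
  rcases l with _ | ⟨x, l⟩
  · split_ifs <;> simp [AA, Pl]
  · split_ifs with h
    · simp only [AA, Pl, Set.mem_ofPred_eq, Set.mem_union, Set.mem_image, List.cons.injEq,
        List.sum_cons, exists_eq_right_right]
      constructor
      · rintro ⟨⟨h1, h2, h3⟩, h4⟩
        rcases Nat.lt_or_ge c x with h5 | h5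
        · obtain rfl : x = c + 1 := by omega
          right; exact ⟨⟨h3, by omega⟩, rfl⟩
        · left; exact ⟨⟨h1, h5, h3⟩, h4⟩
      · rintro (⟨⟨h1, h2, h3⟩, h4⟩ | ⟨⟨h1, h2⟩, rfl⟩)
        · exact ⟨⟨h1, by omega, h3⟩, h4⟩
        · exact ⟨⟨by omega, le_rfl, h1⟩, by omega⟩
    · simp only [AA, Pl, Set.mem_ofPred_eq, Set.union_empty, List.sum_cons]
      constructor
      · rintro ⟨⟨h1, h2, h3⟩, h4⟩
        exact ⟨⟨h1, by omega, h3⟩, h4⟩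
      · rintro ⟨⟨h1, h2, h3⟩, h4⟩
        exact ⟨⟨h1, by omega, h3⟩, h4⟩

theorem AA_finite (N : ℕ) : ∀ m c, (AA m c N).Finite := by
  induction N using Nat.strong_induction_on with
  | _ N ih =>
    intro m c
    induction c with
    | zero => rw [AA_zero]; split_ifs <;> simp
    | succ c ihc =>
      rw [AA_succ]
      refine ihc.union ?_
      split_ifs with h
      · exact (ih _ (by omega) _ _).image _
      · exact Set.finite_empty

noncomputable def FF (m c : ℕ) : ℤ⟦X⟧ := PowerSeries.mk fun N => ((AA m c N).ncard : ℤ)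

theorem FF_zero (m : ℕ) : FF m 0 = 1 := by
  ext N
  rw [FF, coeff_mk, AA_zero, coeff_one]
  split_ifs <;> simp

theorem FF_succ (m c : ℕ) : FF m (c + 1) = FF m c + X ^ (c + 1) * FF (m + 1) ((c + 1) * (m + 2) / (m + 1)) := by
  ext N
  rw [map_add, coeff_X_pow_mul', FF, FF, FF, coeff_mk, coeff_mk, AA_succ]
  split_ifs with h
  · rw [coeff_mk, Set.ncard_union_eq _ (AA_finite _ _ _) ((AA_finite _ _ _).image _),
      Set.ncard_image_of_injective _ (List.cons_injective)]
    · push_cast; rfl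
    · rw [Set.disjoint_left]
      rintro l hl ⟨l', hl', rfl⟩
      have := hl.1.2.1
      omega
  · simp

theorem FF_HH (m c : ℕ) : FF m c * pochInf (-1) 1 1 = HH m c := by
  refine eq_of_dvd fun D => ?_
  induction D generalizing m c with
  | zero => simp
  | succ D ih =>
    induction c with
    | zero => rw [FF_zero, HH_zero, one_mul, sub_self]; exact dvd_zero _
    | succ c ihc =>
      rw [FF_succ, HH_succ]
      have h1 := ih (m + 1) ((c + 1) * (m + 2) / (m + 1))
      have h2 : X ^ (D + 1) ∣ X ^ (c + 1) * (FF (m + 1) ((c + 1) * (m + 2) / (m + 1)) *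
          pochInf (-1) 1 1 - HH (m + 1) ((c + 1) * (m + 2) / (m + 1))) := by
        rw [pow_succ']
        exact mul_dvd_mul (dvd_pow_self _ (by omega)) h1
      have := dvd_add ihc h2
      convert this using 1
      ring

theorem FF_eval (t : ℕ) : FF 0 t * pochInf (-1) 1 1 = pochInf 1 1 1 * pochInf (-1) 1 (t + 2) *
    pochInf (-1) (t + 1) (t + 2) * pochInf (-1) (t + 2) (t + 2) := by
  rw [FF_HH, HH]
  simp only [zero_add, Nat.div_one, Nat.mod_one]
  rw [eval]; ring

theorem Pl_ofFn {k : ℕ} : ∀ (m c : ℕ) (f : Fin k → ℕ), Pl m c (List.ofFn f) ↔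
    (∀ i, 0 < f i) ∧ (∀ i : Fin k, (i : ℕ) = 0 → f i ≤ c) ∧
    ∀ i j : Fin k, (j : ℕ) = (i : ℕ) + 1 → f j * (m + i + 1) ≤ f i * (m + i + 2) := by
  induction k with
  | zero => intro m c f; simp [Pl]
  | succ k ih =>
    intro m c f
    rw [List.ofFn_succ, Pl, ih]
    simp only [Nat.le_div_iff_mul_le (Nat.succ_pos m)]
    constructor
    · rintro ⟨h1, h2, h3, h4, h5⟩
      refine ⟨fun i => ?_, fun i hi => ?_, fun i j hij => ?_⟩
      · refine Fin.cases h1 h3 i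
      · obtain rfl : i = 0 := Fin.ext hi
        exact h2
      · induction j using Fin.cases with
        | zero => simp at hij
        | succ j =>
          induction i using Fin.cases with
          | zero => exact h4 j (by simpa using hij)
          | succ i =>
            have := h5 i j (by simpa using hij)
            simp only [Fin.val_succ]
            rw [show m + (i + 1 : ℕ) + 1 = m + 1 + i + 1 by ring,
              show m + (i + 1 : ℕ) + 2 = m + 1 + i + 2 by ring]
            exact this
    · rintro ⟨h1, h2, h3⟩
      refine ⟨h1 0, h2 0 rfl, fun i => h1 _, fun i hi => ?_, fun i j hij => ?_⟩
      · exact h3 0 i.succ (by simp [hi])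
      · have := h3 i.succ j.succ (by simp [hij])
        simp only [Fin.val_succ] at this
        rw [show m + (i + 1 : ℕ) + 1 = m + 1 + i + 1 by ring,
              show m + (i + 1 : ℕ) + 2 = m + 1 + i + 2 by ring] at this
        exact this

theorem memAt_iff (t k : ℕ) (f : Fin k → ℕ) :
    MemAt t k f ↔ Pl 0 t (List.ofFn (f ∘ Fin.rev)) := by
  rw [Pl_ofFn, MemAt]
  constructor
  · rintro ⟨h1, h2⟩
    have hpos : ∀ n (hn : n < k), 0 < f ⟨n, hn⟩ := by
      intro n
      induction n with
      | zero => intro hn; exact (h1 ⟨0, hn⟩).1 rfl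
      | succ n ih =>
        intro hn
        have h3 := h2 ⟨n, by omega⟩ ⟨n + 1, hn⟩ rfl
        have h4 : 0 < f ⟨n, by omega⟩ * (k - (n + 1)) := Nat.mul_pos (ih (by omega)) (by omega)
        exact Nat.pos_of_mul_pos_right (lt_of_lt_of_le h4 h3)
    refine ⟨fun i => hpos _ _, fun i hi => ?_, fun i j hij => ?_⟩
    · exact (h1 i.rev).2 (by rw [Fin.val_rev]; omega)
    · have h3 := h2 j.rev i.rev (by rw [Fin.val_rev, Fin.val_rev]; omega)
      rw [Fin.val_rev, Fin.val_rev, show k - (k - ((i : ℕ) + 1)) = 0 + i + 1 by omega,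
        show k - (k - ((j : ℕ) + 1)) = 0 + i + 2 by omega] at h3
      exact h3
  · rintro ⟨h1, h2, h3⟩
    refine ⟨fun j => ⟨fun _ => ?_, fun hj => ?_⟩, fun i j hij => ?_⟩
    · have := h1 j.rev; simpa using this
    · have := h2 j.rev (by rw [Fin.val_rev]; omega); simpa using this
    · have := h3 j.rev i.rev (by rw [Fin.val_rev, Fin.val_rev]; omega)
      rw [Fin.val_rev, show 0 + (k - ((j : ℕ) + 1)) + 1 = k - j by omega,
        show 0 + (k - ((j : ℕ) + 1)) + 2 = k - i by omega] at this
      simpa using this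

theorem card_eq (t N : ℕ) :
    Nat.card {p : Σ k : ℕ, Fin k → ℕ // MemAt t p.1 p.2 ∧ ∑ i, p.2 i = N} = (AA 0 t N).ncard := by
  rw [← Nat.card_coe_set_eq]
  let e1 : (Σ k : ℕ, Fin k → ℕ) ≃ (Σ k : ℕ, Fin k → ℕ) :=
    Equiv.sigmaCongrRight fun k => Equiv.arrowCongr Fin.revPerm (Equiv.refl ℕ)
  refine Nat.card_congr (Equiv.subtypeEquiv (e1.trans List.equivSigmaTuple.symm) ?_)
  rintro ⟨k, f⟩
  have h : (e1.trans List.equivSigmaTuple.symm) ⟨k, f⟩ = List.ofFn (f ∘ Fin.rev) := rfl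
  rw [h]
  have h2 : (List.ofFn (f ∘ Fin.rev)).sum = ∑ i, f i := by
    rw [List.sum_ofFn]
    exact Equiv.sum_comp Fin.revPerm f
  show MemAt t k f ∧ ∑ i, f i = N ↔ Pl 0 t (List.ofFn (f ∘ Fin.rev)) ∧ (List.ofFn (f ∘ Fin.rev)).sum = N
  rw [memAt_iff, h2]

/-- **Chen–Sang–Shi**: in `ℤ[[q]]`,
`(∑_{k ≥ 0} ∑_{λ ∈ 𝒜_{t,k}} q^{|λ|}) ⬝ (q;q)_∞
  = (-q;q)_∞ (q;q^{t+2})_∞ (q^{t+1};q^{t+2})_∞ (q^{t+2};q^{t+2})_∞`. -/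
theorem chen_sang_shi (t : ℕ) (ht : 0 < t) :
    (PowerSeries.mk fun N =>
        (Nat.card {p : Σ k : ℕ, Fin k → ℕ //
            MemAt t p.1 p.2 ∧ ∑ i, p.2 i = N} : ℤ)) *
      pochInf (-1) 1 1 =
    pochInf 1 1 1 * pochInf (-1) 1 (t + 2) * pochInf (-1) (t + 1) (t + 2) *
      pochInf (-1) (t + 2) (t + 2) := by
  have h : (PowerSeries.mk fun N =>
      (Nat.card {p : Σ k : ℕ, Fin k → ℕ //
          MemAt t p.1 p.2 ∧ ∑ i, p.2 i = N} : ℤ)) = FF 0 t := by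
    ext N
    rw [FF, coeff_mk, coeff_mk, card_eq]
  rw [h, FF_eval]
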